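/- Let all preferences in P be substitutable and satisfy the law of aggregate demand. For every stable matching μ' ∈ S(P) with μ' ≠ μ_F (the firm-optimal stable matching), there exists a stable matching μ ∈ S(P) such that μ' is a cyclic matching under the reduced preference profile P^μ (the reduced profile with respect to μ and the worker-optimal stable matching μ_W). -/

import Mathlib

open Finset

noncomputable section

open scoped Classical

/-- `C` is a choice function: `C S ⊆ S` for every `S`. -/
def IsChoiceFun {α : Type*} (C : Finset α → Finset α) : Prop := ∀ S, C S ⊆ S

/-- Substitutability of a choice function: if `b` is chosen from `S`, then `b` is chosen
from `S' ∪ {b}` for every `S' ⊆ S`. -/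
def Substitutable {α : Type*} [DecidableEq α] (C : Finset α → Finset α) : Prop :=
  ∀ (S S' : Finset α) (b : α), S' ⊆ S → b ∈ C S → b ∈ C (insert b S')

/-- The law of aggregate demand for a choice function. -/
def LAD {α : Type*} (C : Finset α → Finset α) : Prop :=
  ∀ S' S : Finset α, S' ⊆ S → (C S').card ≤ (C S).card

/-- The most `u`-preferred subset of `S` among the members of the family `A` of acceptable
sets (the empty set is always available as a fallback). -/
def bestIn {α : Type*} (u : Finset α → ℕ) (A : Set (Finset α)) (S : Finset α) : Finset α := by
  classical
  have h : ∃ T ∈ (S.powerset).filter (fun T => T ∈ A ∨ T = ∅),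
      ∀ T' ∈ (S.powerset).filter (fun T => T ∈ A ∨ T = ∅), u T' ≤ u T :=
    Finset.exists_max_image _ u ⟨∅, by simp⟩
  exact h.choose

/-- A many-to-many matching market: each firm `f` has a strict preference over subsets
of workers, represented by an injective utility `uF f`, and symmetrically for workers. -/
structure Market (F W : Type*) where
  uF : F → Finset W → ℕ
  uW : W → Finset F → ℕ
  injF : ∀ f, Function.Injective (uF f)
  injW : ∀ w, Function.Injective (uW w)

/-- A many-to-many matching. -/
structure Matching (F W : Type*) where
  fm : F → Finset W
  wm : W → Finset F
  consistent : ∀ f w, w ∈ fm f ↔ f ∈ wm w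

namespace Market

variable {F W : Type*} [DecidableEq F] [DecidableEq W]

/-- The choice set of firm `f` under the original preference: the most preferred
subset among the acceptable subsets (those strictly preferred to `∅`). -/
def Cf (M : Market F W) (f : F) : Finset W → Finset W :=
  bestIn (M.uF f) {T | M.uF f ∅ < M.uF f T}

/-- The choice set of worker `w` under the original preference. -/
def Cw (M : Market F W) (w : W) : Finset F → Finset F :=
  bestIn (M.uW w) {T | M.uW w ∅ < M.uW w T}

/-- Individual rationality under the original profile. -/
def IR (M : Market F W) (μ : Matching F W) : Prop :=
  (∀ f, M.Cf f (μ.fm f) = μ.fm f) ∧ (∀ w, M.Cw w (μ.wm w) = μ.wm w)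

/-- `(f,w)` blocks `μ` under the original profile. -/
def Blocks (M : Market F W) (μ : Matching F W) (f : F) (w : W) : Prop :=
  w ∉ μ.fm f ∧ w ∈ M.Cf f (insert w (μ.fm f)) ∧ f ∈ M.Cw w (insert f (μ.wm w))

/-- Stability under the original profile. -/
def Stable (M : Market F W) (μ : Matching F W) : Prop :=
  M.IR μ ∧ ∀ f w, ¬ M.Blocks μ f w

/-- Blair's partial order for firm `f`: `S ⪰_f S'` iff `C_f (S ∪ S') = S`. -/
def blairF (M : Market F W) (f : F) (S S' : Finset W) : Prop := M.Cf f (S ∪ S') = S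

/-- Blair's partial order for worker `w`. -/
def blairW (M : Market F W) (w : W) (S S' : Finset F) : Prop := M.Cw w (S ∪ S') = S

/-- The unanimous Blair order for the firms' side: `μ ⪰_F μ'`. -/
def geF (M : Market F W) (μ μ' : Matching F W) : Prop := ∀ f, M.blairF f (μ.fm f) (μ'.fm f)

/-- The unanimous Blair order for the workers' side: `μ ⪰_W μ'`. -/
def geW (M : Market F W) (μ μ' : Matching F W) : Prop := ∀ w, M.blairW w (μ.wm w) (μ'.wm w)

/-- Strict unanimous Blair order for the firms' side: `μ ≻_F μ'`. -/
def gtF (M : Market F W) (μ μ' : Matching F W) : Prop := M.geF μ μ' ∧ μ ≠ μ'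

/-- Workers deleted from `f`'s list in Step 1(a) of the reduction procedure:
those belonging to some `W' ≻_f μ(f)` but not to `μ(f)`. -/
def D1 (M : Market F W) (μ : Matching F W) (f : F) : Set W :=
  {x | ∃ W' : Finset W, (M.Cf f (W' ∪ μ.fm f) = W' ∧ W' ≠ μ.fm f) ∧ x ∈ W' ∧ x ∉ μ.fm f}

/-- Workers deleted from `f`'s list in Step 2(a): those belonging to some `W'` with
`μ̃(f) ≻_f W'` but not to `μ̃(f)`. -/
def D2 (M : Market F W) (μt : Matching F W) (f : F) : Set W :=
  {x | ∃ W' : Finset W, (M.Cf f (μt.fm f ∪ W') = μt.fm f ∧ μt.fm f ≠ W') ∧ x ∈ W' ∧ x ∉ μt.fm f}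

/-- Firms deleted from `w`'s list in Step 1(b). -/
def E1 (M : Market F W) (μt : Matching F W) (w : W) : Set F :=
  {x | ∃ F' : Finset F, (M.Cw w (F' ∪ μt.wm w) = F' ∧ F' ≠ μt.wm w) ∧ x ∈ F' ∧ x ∉ μt.wm w}

/-- Firms deleted from `w`'s list in Step 2(b). -/
def E2 (M : Market F W) (μ : Matching F W) (w : W) : Set F :=
  {x | ∃ F' : Finset F, (M.Cw w (μ.wm w ∪ F') = μ.wm w ∧ μ.wm w ≠ F') ∧ x ∈ F' ∧ x ∉ μ.wm w}

/-- Workers deleted from `f`'s list in Step 3: those workers `w` for which `{f}` is no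
longer on `w`'s list after Steps 1 and 2 (either `{f}` was never acceptable to `w`, or
`f` was deleted from `w`'s list in Step 1(b) or 2(b)). -/
def D3 (M : Market F W) (μ μt : Matching F W) (f : F) : Set W :=
  {w | ¬ (M.uW w ∅ < M.uW w {f}) ∨ f ∈ M.E1 μt w ∪ M.E2 μ w}

/-- Firms deleted from `w`'s list in Step 3. -/
def E3 (M : Market F W) (μ μt : Matching F W) (w : W) : Set F :=
  {f | ¬ (M.uF f ∅ < M.uF f {w}) ∨ w ∈ M.D1 μ f ∪ M.D2 μt f}

/-- All workers deleted from `f`'s list in the reduction procedure. -/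
def Dall (M : Market F W) (μ μt : Matching F W) (f : F) : Set W :=
  M.D1 μ f ∪ M.D2 μt f ∪ M.D3 μ μt f

/-- All firms deleted from `w`'s list in the reduction procedure. -/
def Eall (M : Market F W) (μ μt : Matching F W) (w : W) : Set F :=
  M.E1 μt w ∪ M.E2 μ w ∪ M.E3 μ μt w

/-- The family of sets surviving in `f`'s list under the reduced profile `P^{μ,μ̃}`:
originally acceptable sets containing no deleted worker. -/
def RAf (M : Market F W) (μ μt : Matching F W) (f : F) : Set (Finset W) :=
  {T | M.uF f ∅ < M.uF f T ∧ ∀ x ∈ T, x ∉ M.Dall μ μt f}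

/-- The family of sets surviving in `w`'s list under the reduced profile `P^{μ,μ̃}`. -/
def RAw (M : Market F W) (μ μt : Matching F W) (w : W) : Set (Finset F) :=
  {T | M.uW w ∅ < M.uW w T ∧ ∀ x ∈ T, x ∉ M.Eall μ μt w}

/-- The choice set `C^{μ,μ̃}_f` of firm `f` under the reduced profile. -/
def Cfred (M : Market F W) (μ μt : Matching F W) (f : F) : Finset W → Finset W :=
  bestIn (M.uF f) (M.RAf μ μt f)

/-- The choice set `C^{μ,μ̃}_w` of worker `w` under the reduced profile. -/
def Cwred (M : Market F W) (μ μt : Matching F W) (w : W) : Finset F → Finset F :=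
  bestIn (M.uW w) (M.RAw μ μt w)

/-- Individual rationality under the reduced profile `P^{μ,μ̃}`. -/
def IRred (M : Market F W) (μ μt ν : Matching F W) : Prop :=
  (∀ f, M.Cfred μ μt f (ν.fm f) = ν.fm f) ∧ (∀ w, M.Cwred μ μt w (ν.wm w) = ν.wm w)

/-- Blocking under the reduced profile `P^{μ,μ̃}`. -/
def Blocksred (M : Market F W) (μ μt ν : Matching F W) (f : F) (w : W) : Prop :=
  w ∉ ν.fm f ∧ w ∈ M.Cfred μ μt f (insert w (ν.fm f)) ∧
    f ∈ M.Cwred μ μt w (insert f (ν.wm w))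

/-- Stability under the reduced profile `P^{μ,μ̃}`. -/
def Stablered (M : Market F W) (μ μt ν : Matching F W) : Prop :=
  M.IRred μ μt ν ∧ ∀ f w, ¬ M.Blocksred μ μt ν f w

/-- The unanimous Blair order on the firms' side computed with the reduced choice sets. -/
def geFred (M : Market F W) (μ μt ν ν' : Matching F W) : Prop :=
  ∀ f, M.Cfred μ μt f (ν.fm f ∪ ν'.fm f) = ν.fm f

/-- The unanimous Blair order on the workers' side computed with the reduced choice sets. -/
def geWred (M : Market F W) (μ μt ν ν' : Matching F W) : Prop :=
  ∀ w, M.Cwred μ μt w (ν.wm w ∪ ν'.wm w) = ν.wm w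

/-- All preferences in the market are substitutable. -/
def SubstAll (M : Market F W) : Prop :=
  (∀ f, Substitutable (M.Cf f)) ∧ (∀ w, Substitutable (M.Cw w))

/-- All preferences in the market satisfy the law of aggregate demand. -/
def LADAll (M : Market F W) : Prop :=
  (∀ f, LAD (M.Cf f)) ∧ (∀ w, LAD (M.Cw w))

/-- A cycle for the reduced profile `P^{μ,μ̃}`: an `r`-periodic sequence of worker-firm
pairs `(w_i, f_i)` (indexed cyclically) such that (i) `w_i ∈ μ(f_i) \ μ̃(f_i)`;
(ii) `C^{μ,μ̃}_{f_i}(W \ {w_i}) = (μ(f_i) \ {w_i}) ∪ {w_{i+1}}`; and (iii)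
`C^{μ,μ̃}_{w_{i+1}}(μ(w_{i+1}) ∪ {f_i}) = (μ(w_{i+1}) \ {f_{i+1}}) ∪ {f_i}`. -/
def IsCycle [Fintype W] (M : Market F W) (μ μt : Matching F W) (r : ℕ)
    (w : ℕ → W) (f : ℕ → F) : Prop :=
  0 < r ∧ (∀ i, w (i + r) = w i) ∧ (∀ i, f (i + r) = f i) ∧
  ∀ i, (w i ∈ μ.fm (f i) ∧ w i ∉ μt.fm (f i)) ∧
    M.Cfred μ μt (f i) (Finset.univ \ {w i}) = insert (w (i + 1)) (μ.fm (f i) \ {w i}) ∧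
    M.Cwred μ μt (w (i + 1)) (μ.wm (w (i + 1)) ∪ {f i}) =
      insert (f i) (μ.wm (w (i + 1)) \ {f (i + 1)})

/-- The firm-side assignment of the cyclic matching `μ_σ` obtained from the cycle
`σ = (w, f)` of length `r`. -/
def cyclicFm (μ : Matching F W) (r : ℕ) (w : ℕ → W) (f : ℕ → F) (g : F) : Finset W :=
  if ∃ i ∈ Finset.range r, f i = g then
    (μ.fm g \ ((Finset.range r).filter (fun i => f i = g)).image w) ∪
      ((Finset.range r).filter (fun i => f i = g)).image (fun i => w (i + 1))
  else μ.fm g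

/-- `ν` is a cyclic matching under the reduced profile `P^{μ,μ̃}`: `ν = μ_σ` for some
cycle `σ` for `P^{μ,μ̃}` (the worker side of `ν` is determined by consistency). -/
def IsCyclicMatching [Fintype W] (M : Market F W) (μ μt ν : Matching F W) : Prop :=
  ∃ (r : ℕ) (w : ℕ → W) (f : ℕ → F),
    M.IsCycle μ μt r w f ∧ ∀ g, ν.fm g = cyclicFm μ r w f g

end Market


/-- The properties of choice functions used in the proof. -/
structure GoodC {α : Type*} [DecidableEq α] (C : Finset α → Finset α) : Prop where
  sub : ∀ S, C S ⊆ S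
  irc : ∀ S T, C S ⊆ T → T ⊆ S → C T = C S
  subst : ∀ S T b, T ⊆ S → b ∈ T → b ∈ C S → b ∈ C T
  lad : ∀ S T, T ⊆ S → (C T).card ≤ (C S).card

theorem bestIn_spec {α : Type*} (u : Finset α → ℕ) (A : Set (Finset α)) (S : Finset α) :
    (bestIn u A S ⊆ S ∧ (bestIn u A S ∈ A ∨ bestIn u A S = ∅)) ∧
      ∀ T, T ⊆ S → (T ∈ A ∨ T = ∅) → u T ≤ u (bestIn u A S) := by
  have h : ∃ T ∈ (S.powerset).filter (fun T => T ∈ A ∨ T = ∅),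
      ∀ T' ∈ (S.powerset).filter (fun T => T ∈ A ∨ T = ∅), u T' ≤ u T :=
    Finset.exists_max_image _ u ⟨∅, by simp⟩
  have e : bestIn u A S = h.choose := rfl
  have h1 := h.choose_spec
  rw [← e] at h1
  obtain ⟨h1, h2⟩ := h1
  simp only [Finset.mem_filter, Finset.mem_powerset] at h1 h2
  exact ⟨h1, fun T hT hA => h2 T ⟨hT, hA⟩⟩

theorem bestIn_unique {α : Type*} (u : Finset α → ℕ) (hu : Function.Injective u)
    (A B : Set (Finset α)) (S T : Finset α)
    (h1 : bestIn u A S ⊆ T ∧ (bestIn u A S ∈ B ∨ bestIn u A S = ∅))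
    (h2 : bestIn u B T ⊆ S ∧ (bestIn u B T ∈ A ∨ bestIn u B T = ∅)) :
    bestIn u A S = bestIn u B T :=
  hu (le_antisymm ((bestIn_spec u B T).2 _ h1.1 h1.2) ((bestIn_spec u A S).2 _ h2.1 h2.2))

theorem goodC_bestIn {α : Type*} [DecidableEq α] (u : Finset α → ℕ) (hu : Function.Injective u)
    (A : Set (Finset α)) (hs : Substitutable (bestIn u A)) (hl : LAD (bestIn u A)) :
    GoodC (bestIn u A) where
  sub S := (bestIn_spec u A S).1.1
  irc S T h1 h2 := bestIn_unique u hu A A T S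
    ⟨(bestIn_spec u A T).1.1.trans h2, (bestIn_spec u A T).1.2⟩
    ⟨h1, (bestIn_spec u A S).1.2⟩
  subst S T b h1 h2 h3 := by
    have := hs S T b h1 h3
    rwa [Finset.insert_eq_of_mem h2] at this
  lad S T h := hl T S h

/-- The choice under a reduced list. -/
theorem bestIn_red {α : Type*} [DecidableEq α] (u : Finset α → ℕ) (hu : Function.Injective u)
    (D : Set α) (S R U : Finset α)
    (hRU : R = bestIn u {T | u ∅ < u T} U) (hRS : R ⊆ S) (hRD : ∀ x ∈ R, x ∉ D)
    (hSU : ∀ x ∈ S, x ∉ D → x ∈ U) :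
    bestIn u {T | u ∅ < u T ∧ ∀ x ∈ T, x ∉ D} S = R := by
  subst hRU
  apply bestIn_unique u hu
  · have h := bestIn_spec u {T | u ∅ < u T ∧ ∀ x ∈ T, x ∉ D} S
    rcases h.1.2 with h' | h'
    · exact ⟨fun x hx => hSU x (h.1.1 hx) (h'.2 x hx), Or.inl h'.1⟩
    · rw [h']; simp
  · refine ⟨hRS, ?_⟩
    rcases (bestIn_spec u {T | u ∅ < u T} U).1.2 with h' | h'
    · exact Or.inl ⟨h', hRD⟩
    · exact Or.inr h'

namespace GoodC

variable {α : Type*} [DecidableEq α] {C : Finset α → Finset α}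

theorem idem (h : GoodC C) {S A : Finset α} (e : C S = A) : C A = A := by
  rw [h.irc S A (by rw [e]) (by rw [← e]; exact h.sub S), e]

theorem between (h : GoodC C) {S A T : Finset α} (e : C S = A) (h1 : A ⊆ T) (h2 : T ⊆ S) :
    C T = A := by
  rw [h.irc S T (by rw [e]; exact h1) h2, e]

theorem trans (h : GoodC C) {A B D : Finset α} (h1 : C (A ∪ B) = A) (h2 : C (B ∪ D) = B) :
    C (A ∪ D) = A := by
  have hs : C (A ∪ B ∪ D) ⊆ A := by
    intro x hx
    have hx' := h.sub _ hx
    simp only [Finset.mem_union] at hx'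
    by_cases hA : x ∈ A
    · exact hA
    have hB : x ∈ B := by
      rw [← h2]
      exact h.subst _ _ x (by grind) (by grind) hx
    rw [← h1]
    exact h.subst _ _ x (by grind) (by grind) hx
  have e := h.irc (A ∪ B ∪ D) (A ∪ B) (by grind) (by grind)
  exact h.between (e.symm.trans h1) (by grind) (by grind)

theorem insert_eq (h : GoodC C) {S A : Finset α} (e : C S = A) (x : α) :
    C (insert x S) = C (insert x A) := by
  have hAS : A ⊆ S := by rw [← e]; exact h.sub S
  symm
  apply h.irc
  · intro y hy
    have hy' := h.sub _ hy
    simp only [Finset.mem_insert] at hy' ⊢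
    rcases hy' with rfl | hy'
    · exact Or.inl rfl
    · right
      rw [← e]
      exact h.subst _ _ y (by grind) hy' hy
  · exact Finset.insert_subset_insert _ hAS

/-- If `x` is not chosen from `insert x A` with `A` self-chosen then `A` is chosen. -/
theorem insert_not_mem (h : GoodC C) {A : Finset α} (e : C A = A) {x : α}
    (hx : x ∉ C (insert x A)) : C (insert x A) = A := by
  have : C (insert x A) ⊆ A := by
    intro y hy
    have := h.sub _ hy
    grind
  rw [← h.irc _ A this (by grind), e]

/-- If no element of `S \ A` is chosen against `A`, then `A` is chosen from `S`. -/
theorem eq_of_forall (h : GoodC C) {A S : Finset α} (e : C A = A) (hAS : A ⊆ S)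
    (hx : ∀ x ∈ S, x ∉ A → x ∉ C (insert x A)) : C S = A := by
  have : C S ⊆ A := by
    intro y hy
    by_contra hyA
    have hyS := h.sub _ hy
    exact hx y hyS hyA (h.subst _ _ y (by grind) (by grind) hy)
  rw [← h.irc _ A this hAS, e]

end GoodC

namespace Market

section helpers

set_option linter.unusedSectionVars false

variable {F W : Type*} [DecidableEq F] [DecidableEq W]

theorem goodF {M : Market F W} (hsub : M.SubstAll) (hlad : M.LADAll) (f : F) :
    GoodC (M.Cf f) := goodC_bestIn _ (M.injF f) _ (hsub.1 f) (hlad.1 f)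

theorem goodW {M : Market F W} (hsub : M.SubstAll) (hlad : M.LADAll) (w : W) :
    GoodC (M.Cw w) := goodC_bestIn _ (M.injW w) _ (hsub.2 w) (hlad.2 w)

theorem _root_.Matching.ext_fm {μ ν : Matching F W} (h : ∀ f, μ.fm f = ν.fm f) : μ = ν := by
  obtain ⟨a, b, c⟩ := μ
  obtain ⟨a', b', c'⟩ := ν
  have h1 : a = a' := funext h
  subst h1
  have h2 : b = b' := by
    funext w
    ext f
    rw [← c, ← c']
  subst h2
  rfl

theorem _root_.Matching.ext_wm {μ ν : Matching F W} (h : ∀ w, μ.wm w = ν.wm w) : μ = ν := by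
  apply Matching.ext_fm
  intro f
  ext w
  rw [μ.consistent, ν.consistent, h]

theorem geW_of_geF {M : Market F W} (hsub : M.SubstAll) (hlad : M.LADAll)
    {μ ν : Matching F W} (hν : M.Stable ν) (h : M.geF μ ν) : M.geW ν μ := by
  intro w
  apply (goodW hsub hlad w).eq_of_forall (hν.1.2 w) (by grind)
  intro f hf hfn hfc
  have hfμ : w ∈ μ.fm f := by rw [μ.consistent]; grind
  refine hν.2 f w ⟨by rw [ν.consistent]; exact hfn, ?_, hfc⟩
  have := h f
  unfold blairF at this
  rw [← this] at hfμ
  exact (goodF hsub hlad f).subst _ _ w (by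
    have := (goodF hsub hlad f).sub _ hfμ
    grind) (by grind) hfμ

theorem geF_of_geW {M : Market F W} (hsub : M.SubstAll) (hlad : M.LADAll)
    {μ ν : Matching F W} (hν : M.Stable ν) (h : M.geW μ ν) : M.geF ν μ := by
  intro f
  apply (goodF hsub hlad f).eq_of_forall (hν.1.1 f) (by grind)
  intro w hf hfn hfc
  have hfμ : f ∈ μ.wm w := by rw [← μ.consistent]; grind
  refine hν.2 f w ⟨hfn, hfc, ?_⟩
  have := h w
  unfold blairW at this
  rw [← this] at hfμ
  exact (goodW hsub hlad w).subst _ _ f (by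
    have := (goodW hsub hlad w).sub _ hfμ
    grind) (by grind) hfμ

theorem double_count [Fintype W] (μ : Matching F W) (A : Finset F)
    (hA : ∀ w, μ.wm w ⊆ A) : ∑ f ∈ A, (μ.fm f).card = ∑ w, (μ.wm w).card := by
  have h := Finset.sum_card_bipartiteAbove_eq_sum_card_bipartiteBelow
    (s := A) (t := (Finset.univ : Finset W)) (fun f w => w ∈ μ.fm f)
  have e1 : ∀ f, Finset.bipartiteAbove (fun f w => w ∈ μ.fm f) (Finset.univ : Finset W) f
      = μ.fm f := by
    intro f; ext w; simp [Finset.bipartiteAbove]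
  have e2 : ∀ w, Finset.bipartiteBelow (fun f w => w ∈ μ.fm f) A w = μ.wm w := by
    intro w; ext f
    simp only [Finset.bipartiteBelow, Finset.mem_filter, μ.consistent]
    exact ⟨fun h => h.2, fun h => ⟨hA w h, h⟩⟩
  simpa only [e1, e2] using h

theorem rural [Fintype W] {M : Market F W} (hsub : M.SubstAll) (hlad : M.LADAll)
    {μ ν : Matching F W} (hμ : M.Stable μ) (hν : M.Stable ν) (h : M.geF μ ν) :
    (∀ f, (μ.fm f).card = (ν.fm f).card) ∧ (∀ w, (μ.wm w).card = (ν.wm w).card) := by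
  have hF : ∀ f, (ν.fm f).card ≤ (μ.fm f).card := by
    intro f
    have h1 := (goodF hsub hlad f).lad (μ.fm f ∪ ν.fm f) (ν.fm f) (by grind)
    rwa [hν.1.1 f, h f] at h1
  have hW : ∀ w, (μ.wm w).card ≤ (ν.wm w).card := by
    intro w
    have h1 := (goodW hsub hlad w).lad (ν.wm w ∪ μ.wm w) (μ.wm w) (by grind)
    rwa [hμ.1.2 w, geW_of_geF hsub hlad hν h w] at h1
  let A : Finset F := Finset.univ.biUnion (fun w => μ.wm w ∪ ν.wm w)
  have d1 := double_count μ A (by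
    intro w f hf
    exact Finset.mem_biUnion.2 ⟨w, Finset.mem_univ _, by grind⟩)
  have d2 := double_count ν A (by
    intro w f hf
    exact Finset.mem_biUnion.2 ⟨w, Finset.mem_univ _, by grind⟩)
  have s1 := Finset.sum_le_sum (fun f (_ : f ∈ A) => hF f)
  have s2 := Finset.sum_le_sum (fun w (_ : w ∈ (Finset.univ : Finset W)) => hW w)
  have t1 := (Finset.sum_eq_sum_iff_of_le (fun f (_ : f ∈ A) => hF f)).1 (by omega)
  have t2 := (Finset.sum_eq_sum_iff_of_le
    (fun w (_ : w ∈ (Finset.univ : Finset W)) => hW w)).1 (by omega)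
  refine ⟨fun f => ?_, fun w => t2 w (Finset.mem_univ _)⟩
  by_cases hf : f ∈ A
  · exact (t1 f hf).symm
  · have e : ∀ ρ : Matching F W, (ρ = μ ∨ ρ = ν) → ρ.fm f = ∅ := by
      intro ρ hρ
      rw [Finset.eq_empty_iff_forall_notMem]
      intro w hw
      rw [ρ.consistent] at hw
      apply hf
      refine Finset.mem_biUnion.2 ⟨w, Finset.mem_univ _, ?_⟩
      rcases hρ with rfl | rfl <;> grind
    rw [e μ (Or.inl rfl), e ν (Or.inr rfl)]

/-- Existence of a stable matching covering `μ'` from above. -/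
theorem exists_cover [Fintype W] {M : Market F W} (hsub : M.SubstAll) (hlad : M.LADAll)
    {μF μ' : Matching F W} (hμF : M.Stable μF) (hμ' : M.Stable μ') (hge : M.geF μF μ')
    (hne : μ' ≠ μF) :
    ∃ μ, M.Stable μ ∧ M.geF μ μ' ∧ μ ≠ μ' ∧
      ∀ ν, M.Stable ν → M.geF μ ν → M.geF ν μ' → ν ≠ μ → ν = μ' := by
  let V : Matching F W → ℕ := fun ν => ∑ w, M.uW w (ν.wm w)
  have hmono : ∀ ν ρ : Matching F W, M.geW ρ ν → (∀ w, M.Cw w (ν.wm w) = ν.wm w) →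
      ∀ w, M.uW w (ν.wm w) ≤ M.uW w (ρ.wm w) := by
    intro ν ρ h hν w
    have h1 := bestIn_spec (M.uW w) {T | M.uW w ∅ < M.uW w T} (ρ.wm w ∪ ν.wm w)
    have h2 := bestIn_spec (M.uW w) {T | M.uW w ∅ < M.uW w T} (ν.wm w)
    have e1 : bestIn (M.uW w) {T | M.uW w ∅ < M.uW w T} (ρ.wm w ∪ ν.wm w) = ρ.wm w := h w
    have e2 : bestIn (M.uW w) {T | M.uW w ∅ < M.uW w T} (ν.wm w) = ν.wm w := hν w
    rw [e1] at h1
    rw [e2] at h2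
    exact h1.2 _ (by grind) h2.1.2
  let P : ℕ → Prop := fun n => ∃ ν, (M.Stable ν ∧ M.geF ν μ' ∧ ν ≠ μ') ∧ V μ' - V ν = n
  have hP : ∃ n, P n := ⟨_, μF, ⟨hμF, hge, hne.symm⟩, rfl⟩
  obtain ⟨μ, ⟨h1, h2, h3⟩, h4⟩ := Nat.find_spec hP
  refine ⟨μ, h1, h2, h3, ?_⟩
  intro ν hν ha hb hc
  by_contra hd
  have hmin := Nat.find_min' hP (⟨ν, ⟨hν, hb, hd⟩, rfl⟩ : P (V μ' - V ν))
  rw [← h4] at hmin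
  have m1 := hmono μ ν (geW_of_geF hsub hlad hν ha) h1.1.2
  have m2 := hmono ν μ' (geW_of_geF hsub hlad hμ' hb) hν.1.2
  have s1 : V μ ≤ V ν := Finset.sum_le_sum (fun w _ => m1 w)
  have s2 : V ν ≤ V μ' := Finset.sum_le_sum (fun w _ => m2 w)
  have s3 : V μ = V ν := by omega
  have := (Finset.sum_eq_sum_iff_of_le (fun w (_ : w ∈ (Finset.univ : Finset W)) => m1 w)).1 s3
  apply hc
  apply Matching.ext_wm
  intro w
  exact (M.injW w (this w (Finset.mem_univ _))).symm

/-- Pairs that survive the reduction. -/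
theorem alive {M : Market F W} (hsub : M.SubstAll) (hlad : M.LADAll)
    {μ μt : Matching F W} (hμ : M.Stable μ) (hμt : M.Stable μt) {f : F} {w : W}
    (h1 : w ∈ M.Cf f (insert w (μt.fm f))) (h2 : f ∈ M.Cw w (insert f (μ.wm w))) :
    w ∉ M.Dall μ μt f ∧ f ∉ M.Eall μ μt w := by
  have gF := goodF hsub hlad f
  have gW := goodW hsub hlad w
  have acF : M.uF f ∅ < M.uF f {w} := by
    have h : w ∈ M.Cf f {w} := gF.subst _ _ w (by grind) (by grind) h1
    have hs := bestIn_spec (M.uF f) {T | M.uF f ∅ < M.uF f T} {w}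
    have e : bestIn (M.uF f) {T | M.uF f ∅ < M.uF f T} {w} = {w} := by
      apply Finset.Subset.antisymm hs.1.1
      intro x hx
      rw [Finset.mem_singleton.1 hx]
      exact h
    rw [e] at hs
    rcases hs.1.2 with h' | h'
    · exact h'
    · simp at h'
  have acW : M.uW w ∅ < M.uW w {f} := by
    have h : f ∈ M.Cw w {f} := gW.subst _ _ f (by grind) (by grind) h2
    have hs := bestIn_spec (M.uW w) {T | M.uW w ∅ < M.uW w T} {f}
    have e : bestIn (M.uW w) {T | M.uW w ∅ < M.uW w T} {f} = {f} := by
      apply Finset.Subset.antisymm hs.1.1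
      intro x hx
      rw [Finset.mem_singleton.1 hx]
      exact h
    rw [e] at hs
    rcases hs.1.2 with h' | h'
    · exact h'
    · simp at h'
  have d1 : w ∉ M.D1 μ f := by
    rintro ⟨W', ⟨e, -⟩, hw, hn⟩
    rw [← e] at hw
    have := gF.sub _ hw
    rw [e] at hw
    refine hμ.2 f w ⟨hn, gF.subst _ _ w ?_ (by grind) (by rw [e]; exact hw), h2⟩
    grind
  have d2 : w ∉ M.D2 μt f := by
    rintro ⟨W', ⟨e, -⟩, hw, hn⟩
    apply hn
    rw [gF.between (T := insert w (μt.fm f)) e (by grind) (by grind)] at h1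
    exact h1
  have e1 : f ∉ M.E1 μt w := by
    rintro ⟨F', ⟨e, -⟩, hw, hn⟩
    refine hμt.2 f w ⟨by rw [μt.consistent]; exact hn, h1,
      gW.subst _ _ f ?_ (by grind) (by rw [e]; exact hw)⟩
    grind
  have e2 : f ∉ M.E2 μ w := by
    rintro ⟨F', ⟨e, -⟩, hw, hn⟩
    apply hn
    rw [gW.between (T := insert f (μ.wm w)) e (by grind) (by grind)] at h2
    exact h2
  constructor
  · rintro ((h | h) | (h | (h | h)))
    · exact d1 h
    · exact d2 h
    · exact h acW
    · exact e1 h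
    · exact e2 h
  · rintro ((h | h) | (h | (h | h)))
    · exact e1 h
    · exact e2 h
    · exact h acF
    · exact d1 h
    · exact d2 h

/-- Workers willing to be with `f` given `μ`. -/
def willing [Fintype W] (M : Market F W) (μ : Matching F W) (f : F) : Finset W :=
  Finset.univ.filter (fun x => f ∈ M.Cw x (insert f (μ.wm x)))

theorem mem_willing [Fintype W] {M : Market F W} {μ : Matching F W} {f : F} {x : W} :
    x ∈ M.willing μ f ↔ f ∈ M.Cw x (insert f (μ.wm x)) := by simp [willing]

theorem sub_willing [Fintype W] {M : Market F W} (hsub : M.SubstAll) (hlad : M.LADAll)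
    {μ ν : Matching F W} (h : M.geW ν μ) (f : F) : ν.fm f ⊆ M.willing μ f := by
  intro x hx
  rw [mem_willing]
  rw [ν.consistent] at hx
  have e : M.Cw x (ν.wm x ∪ μ.wm x) = ν.wm x := h x
  exact (goodW hsub hlad x).subst (ν.wm x ∪ μ.wm x) _ f (by grind) (by grind) (by rw [e]; exact hx)

theorem choice_willing [Fintype W] {M : Market F W} (hsub : M.SubstAll) (hlad : M.LADAll)
    {μ : Matching F W} (hμ : M.Stable μ) (f : F) :
    μ.fm f ⊆ M.willing μ f ∧ M.Cf f (M.willing μ f) = μ.fm f := by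
  have h0 : μ.fm f ⊆ M.willing μ f := by
    apply sub_willing hsub hlad
    intro w
    unfold blairW
    rw [Finset.union_self, hμ.1.2]
  refine ⟨h0, (goodF hsub hlad f).eq_of_forall (hμ.1.1 f) h0 ?_⟩
  intro x hx hxn hxc
  exact hμ.2 f x ⟨hxn, hxc, mem_willing.1 hx⟩

/-- One step: from a pair `(w,f)` in `μ` not in `μ'` to the next pair. -/
theorem step [Fintype W] {M : Market F W} (hsub : M.SubstAll) (hlad : M.LADAll)
    {μ μ' : Matching F W} (hμ : M.Stable μ) (hμ' : M.Stable μ') (hge : M.geF μ μ')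
    {w : W} {f : F} (hw : w ∈ μ.fm f) (hw' : w ∉ μ'.fm f) :
    ∃ x g, x ∉ μ.fm f ∧ x ∈ μ.fm g ∧ x ∉ μ'.fm g ∧
      M.Cf f (M.willing μ f \ {w}) = insert x (μ.fm f \ {w}) ∧
      M.Cw x (insert f (μ.wm x)) = insert f (μ.wm x \ {g}) := by
  have gF := goodF hsub hlad f
  have hgeW := geW_of_geF hsub hlad hμ' hge
  obtain ⟨hrF, hrW⟩ := rural hsub hlad hμ hμ' hge
  obtain ⟨hT, hCT⟩ := choice_willing hsub hlad hμ f
  have hT' := sub_willing hsub hlad hgeW f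
  have hT'w : μ'.fm f ⊆ M.willing μ f \ {w} := by grind
  have hsub1 : μ.fm f \ {w} ⊆ M.Cf f (M.willing μ f \ {w}) := by
    intro y hy
    exact gF.subst (M.willing μ f) _ y (by grind) (by grind) (by rw [hCT]; grind)
  have hc1 := gF.lad _ _ (Finset.sdiff_subset : M.willing μ f \ {w} ⊆ M.willing μ f)
  rw [hCT] at hc1
  have hc2 := gF.lad _ _ hT'w
  rw [hμ'.1.1 f, ← hrF f] at hc2
  have hcw : (μ.fm f \ {w}).card + 1 = (μ.fm f).card := by
    rw [Finset.sdiff_singleton_eq_erase, Finset.card_erase_add_one hw]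
  obtain ⟨x, hx⟩ : ∃ x, M.Cf f (M.willing μ f \ {w}) \ (μ.fm f \ {w}) = {x} := by
    rw [← Finset.card_eq_one, Finset.card_sdiff_of_subset hsub1]
    omega
  have hxC : M.Cf f (M.willing μ f \ {w}) = insert x (μ.fm f \ {w}) := by
    rw [← Finset.sdiff_union_of_subset hsub1, hx]; rfl
  have hxm : x ∈ M.Cf f (M.willing μ f \ {w}) := by rw [hxC]; grind
  have hxw := gF.sub _ hxm
  have hxn : x ∉ μ.fm f := by
    have : x ∈ M.Cf f (M.willing μ f \ {w}) \ (μ.fm f \ {w}) := by rw [hx]; simp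
    grind
  have gW := goodW hsub hlad x
  have hfx : f ∈ M.Cw x (insert f (μ.wm x)) := mem_willing.1 (by grind)
  have hx' : x ∈ M.Cf f (insert x (μ'.fm f)) := gF.subst _ _ x (by grind) (by grind) hxm
  -- the worker's side
  have hbig : M.Cw x (insert f (μ'.wm x ∪ μ.wm x)) = μ'.wm x := by
    rw [gW.insert_eq (hgeW x) f]
    by_cases hfm : f ∈ μ'.wm x
    · rw [Finset.insert_eq_of_mem hfm, hμ'.1.2]
    · apply gW.insert_not_mem (hμ'.1.2 x)
      intro hc
      exact hμ'.2 f x ⟨by rw [μ'.consistent]; exact hfm, hx', hc⟩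
  have hc3 := gW.lad (insert f (μ'.wm x ∪ μ.wm x)) (insert f (μ.wm x)) (by grind)
  rw [hbig, ← hrW x] at hc3
  have hc4 := gW.lad (insert f (μ.wm x)) (μ.wm x) (by grind)
  rw [hμ.1.2 x] at hc4
  have hfn : f ∉ μ.wm x := by rw [← μ.consistent]; exact hxn
  have hsub2 := gW.sub (insert f (μ.wm x))
  obtain ⟨g, hg⟩ : ∃ g, (insert f (μ.wm x)) \ M.Cw x (insert f (μ.wm x)) = {g} := by
    rw [← Finset.card_eq_one, Finset.card_sdiff_of_subset hsub2, Finset.card_insert_of_notMem hfn]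
    omega
  have hgm : g ∈ (insert f (μ.wm x)) \ M.Cw x (insert f (μ.wm x)) := by rw [hg]; simp
  have hgf : g ≠ f := by
    rintro rfl
    grind
  have hgx : g ∈ μ.wm x := by grind
  refine ⟨x, g, hxn, by rw [μ.consistent]; exact hgx, ?_, hxC, ?_⟩
  · rw [μ'.consistent]
    intro hc
    have : g ∈ M.Cw x (insert f (μ.wm x)) :=
      gW.subst (insert f (μ'.wm x ∪ μ.wm x)) _ g (by grind) (by grind) (by rw [hbig]; exact hc)
    grind
  · ext y
    have hy := Finset.ext_iff.1 hg y
    have := @hsub2 y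
    simp only [Finset.mem_sdiff, Finset.mem_insert, Finset.mem_singleton] at hy this ⊢
    grind

theorem rotate [Fintype W] {M : Market F W} (hsub : M.SubstAll) (hlad : M.LADAll)
    {μ μ' ν : Matching F W} (hμ : M.Stable μ) (hμ' : M.Stable μ') (hge : M.geF μ μ')
    (O : Finset (W × F)) (φ : W × F → W × F) (hne : O.Nonempty) (hφ : O.image φ = O)
    (hO : ∀ e ∈ O, e.1 ∈ μ.fm e.2 ∧ e.1 ∉ μ'.fm e.2)
    (h0 : ∀ e ∈ O, (φ e).1 ∉ μ.fm e.2)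
    (hF : ∀ e ∈ O, M.Cf e.2 (M.willing μ e.2 \ {e.1}) = insert (φ e).1 (μ.fm e.2 \ {e.1}))
    (hW : ∀ e ∈ O, M.Cw (φ e).1 (insert e.2 (μ.wm (φ e).1)) =
      insert e.2 (μ.wm (φ e).1 \ {(φ e).2}))
    (hν : ∀ f w, w ∈ ν.fm f ↔ (w ∈ μ.fm f ∧ (w, f) ∉ O) ∨ ∃ e ∈ O, e.2 = f ∧ (φ e).1 = w) :
    M.Stable ν ∧ M.geF μ ν ∧ M.geF ν μ' ∧ ν ≠ μ := by
  have hgeW := geW_of_geF hsub hlad hμ' hge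
  have hφO : ∀ e ∈ O, φ e ∈ O := fun e he => by
    have := Finset.mem_image_of_mem φ he
    rwa [hφ] at this
  have hφS : ∀ e ∈ O, ∃ e' ∈ O, φ e' = e := fun e he => by
    rw [← hφ] at he
    simpa using he
  have hinj : Set.InjOn φ (O : Set (W × F)) := Finset.card_image_iff.1 (by rw [hφ])
  have hinj2 : ∀ e ∈ O, ∀ e' ∈ O, e.2 = e'.2 → (φ e).1 = (φ e').1 → e = e' := by
    intro e he e' he' h1 h2
    apply hinj he he'
    apply Prod.ext h2
    have a := hW e he
    have a' := hW e' he'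
    rw [← h2, ← h1] at a'
    have b := h0 e he
    have c := (hO _ (hφO e he)).1
    rw [μ.consistent] at b c
    rw [a'] at a
    have := Finset.ext_iff.1 a (φ e).2
    simp only [Finset.mem_insert, Finset.mem_sdiff, Finset.mem_singleton] at this
    by_contra hn
    have h3 : (φ e).2 ≠ e.2 := fun h => b (h ▸ c)
    tauto
  -- firms
  have kF : ∀ f, ∃ S, M.Cf f S = ν.fm f ∧ μ'.fm f ⊆ S ∧
      (∀ x, x ∈ S ↔ x ∈ M.willing μ f ∧ (x, f) ∉ O) := by
    intro f
    have gF := goodF hsub hlad f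
    obtain ⟨hT, hCT⟩ := choice_willing hsub hlad hμ f
    let S := (M.willing μ f).filter (fun x => (x, f) ∉ O)
    have hS : ∀ x, x ∈ S ↔ x ∈ M.willing μ f ∧ (x, f) ∉ O := by simp [S]
    refine ⟨S, ?_, ?_, hS⟩
    · symm
      apply Finset.eq_of_subset_of_card_le
      · intro x hx
        rcases (hν f x).1 hx with ⟨h1, h2⟩ | ⟨e, he, rfl, rfl⟩
        · exact gF.subst (M.willing μ f) _ x (fun y hy => ((hS y).1 hy).1)
            ((hS x).2 ⟨hT h1, h2⟩) (by rw [hCT]; exact h1)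
        · have hm : (φ e).1 ∈ M.Cf e.2 (M.willing μ e.2 \ {e.1}) := by
            rw [hF e he]; simp
          have hm' := gF.sub _ hm
          refine gF.subst _ _ _ (fun y hy => ?_) ((hS _).2 ⟨by grind, ?_⟩) hm
          · have := (hS y).1 hy
            simp only [Finset.mem_sdiff, Finset.mem_singleton]
            refine ⟨this.1, ?_⟩
            rintro rfl
            exact this.2 he
          · intro hc
            exact h0 e he (hO _ hc).1
      · have hc := gF.lad (M.willing μ f) S (fun y hy => ((hS y).1 hy).1)
        rw [hCT] at hc
        refine hc.trans ?_
        let Of := O.filter (fun e => e.2 = f)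
        have hOf : ∀ e, e ∈ Of ↔ e ∈ O ∧ e.2 = f := by simp [Of]
        let R := Of.image Prod.fst
        let A := Of.image (fun e => (φ e).1)
        have hA : A.card = Of.card := by
          apply Finset.card_image_of_injOn
          intro e he e' he' h
          have h1 := (hOf e).1 he
          have h2 := (hOf e').1 he'
          exact hinj2 e h1.1 e' h2.1 (h1.2.trans h2.2.symm) h
        have hR : R.card ≤ Of.card := Finset.card_image_le
        have hRμ : R ⊆ μ.fm f := by
          intro x hx
          obtain ⟨e, he, rfl⟩ := Finset.mem_image.1 hx
          have h1 := (hOf e).1 he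
          rw [← h1.2]
          exact (hO e h1.1).1
        have hd : Disjoint (μ.fm f \ R) A := by
          rw [Finset.disjoint_left]
          intro x hx hxA
          obtain ⟨e, he, rfl⟩ := Finset.mem_image.1 hxA
          have h1 := (hOf e).1 he
          apply h0 e h1.1
          rw [h1.2]
          exact (Finset.mem_sdiff.1 hx).1
        have he : (μ.fm f \ R) ∪ A ⊆ ν.fm f := by
          intro x hx
          rw [hν]
          rcases Finset.mem_union.1 hx with hx | hx
          · left
            rw [Finset.mem_sdiff] at hx
            refine ⟨hx.1, fun hc => hx.2 ?_⟩
            exact Finset.mem_image.2 ⟨(x, f), (hOf _).2 ⟨hc, rfl⟩, rfl⟩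
          · right
            obtain ⟨e, he, rfl⟩ := Finset.mem_image.1 hx
            have h1 := (hOf e).1 he
            exact ⟨e, h1.1, h1.2, rfl⟩
        have h1 := Finset.card_le_card he
        rw [Finset.card_union_of_disjoint hd, Finset.card_sdiff_of_subset hRμ] at h1
        have := Finset.card_le_card hRμ
        omega
    · intro x hx
      rw [hS]
      exact ⟨sub_willing hsub hlad hgeW f hx, fun hc => (hO _ hc).2 hx⟩
  -- workers
  have kW : ∀ x, ∃ S, M.Cw x S = ν.wm x ∧ μ.wm x ⊆ S := by
    intro x
    have gW := goodW hsub hlad x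
    let Oa := O.filter (fun e => (φ e).1 = x)
    have hOa : ∀ e, e ∈ Oa ↔ e ∈ O ∧ (φ e).1 = x := by simp [Oa]
    let Or := O.filter (fun e => e.1 = x)
    have hOr : ∀ e, e ∈ Or ↔ e ∈ O ∧ e.1 = x := by simp [Or]
    let R := Or.image Prod.snd
    let A := Oa.image Prod.snd
    have hνx : ν.wm x = (μ.wm x \ R) ∪ A := by
      ext f
      rw [← ν.consistent, hν]
      simp only [Finset.mem_union, Finset.mem_sdiff, ← μ.consistent]
      have e1 : f ∈ R ↔ (x, f) ∈ O := by
        constructor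
        · intro h
          obtain ⟨e, he, rfl⟩ := Finset.mem_image.1 h
          have := (hOr e).1 he
          rw [← this.2]
          exact this.1
        · intro h
          exact Finset.mem_image.2 ⟨(x, f), (hOr _).2 ⟨h, rfl⟩, rfl⟩
      have e2 : f ∈ A ↔ ∃ e ∈ O, e.2 = f ∧ (φ e).1 = x := by
        constructor
        · intro h
          obtain ⟨e, he, rfl⟩ := Finset.mem_image.1 h
          have := (hOa e).1 he
          exact ⟨e, this.1, rfl, this.2⟩
        · rintro ⟨e, he, h1, h2⟩
          exact Finset.mem_image.2 ⟨e, (hOa _).2 ⟨he, h2⟩, h1⟩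
      rw [e1, e2]
    refine ⟨μ.wm x ∪ A, ?_, Finset.subset_union_left⟩
    apply Finset.eq_of_subset_of_card_le
    · intro f hf
      have hf' := gW.sub _ hf
      rw [hνx]
      by_cases hfA : f ∈ A
      · exact Finset.mem_union_right _ hfA
      apply Finset.mem_union_left
      have hfμ : f ∈ μ.wm x := by grind
      refine Finset.mem_sdiff.2 ⟨hfμ, fun hR => ?_⟩
      obtain ⟨e, he, rfl⟩ := Finset.mem_image.1 hR
      obtain ⟨heO, rfl⟩ := (hOr e).1 he
      obtain ⟨e', he', rfl⟩ := hφS e heO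
      have hA' : e'.2 ∈ A := Finset.mem_image.2 ⟨e', (hOa _).2 ⟨he', rfl⟩, rfl⟩
      have := gW.subst _ (insert e'.2 (μ.wm (φ e').1)) _ (by grind) (by grind) hf
      rw [hW e' he'] at this
      simp only [Finset.mem_insert, Finset.mem_sdiff, Finset.mem_singleton] at this
      rcases this with h | h
      · exact hfA (h ▸ hA')
      · exact h.2 trivial
    · have hc := gW.lad (μ.wm x ∪ A) (μ.wm x) Finset.subset_union_left
      rw [hμ.1.2 x] at hc
      refine le_trans ?_ hc
      have hRμ : R ⊆ μ.wm x := by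
        intro f hf
        obtain ⟨e, he, rfl⟩ := Finset.mem_image.1 hf
        obtain ⟨heO, rfl⟩ := (hOr e).1 he
        rw [← μ.consistent]
        exact (hO e heO).1
      have hR : R.card = Or.card := by
        apply Finset.card_image_of_injOn
        intro e he e' he' h
        exact Prod.ext (((hOr e).1 he).2.trans ((hOr e').1 he').2.symm) h
      have hA : A.card ≤ Oa.card := Finset.card_image_le
      have hAR : Oa.card ≤ Or.card := by
        apply Finset.card_le_card_of_injOn φ
        · intro e he
          have := (hOa e).1 he
          exact (hOr _).2 ⟨hφO e this.1, this.2⟩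
        · intro e he e' he' h
          exact hinj ((hOa e).1 he).1 ((hOa e').1 he').1 h
      have h1 := Finset.card_union_le (μ.wm x \ R) A
      rw [Finset.card_sdiff_of_subset hRμ] at h1
      have := Finset.card_le_card hRμ
      rw [hνx]
      omega
  refine ⟨⟨⟨fun f => ?_, fun x => ?_⟩, ?_⟩, fun f => ?_, fun f => ?_, ?_⟩
  · obtain ⟨S, e, -⟩ := kF f
    exact (goodF hsub hlad f).idem e
  · obtain ⟨S, e, -⟩ := kW x
    exact (goodW hsub hlad x).idem e
  · rintro f x ⟨b1, b2, b3⟩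
    have gF := goodF hsub hlad f
    have gW := goodW hsub hlad x
    obtain ⟨S, e, -, hS⟩ := kF f
    obtain ⟨S', e', hS'⟩ := kW x
    have hνS : ν.fm f ⊆ S := by rw [← e]; exact gF.sub S
    have hνS' : ν.wm x ⊆ S' := by rw [← e']; exact gW.sub S'
    rw [← gW.insert_eq e' f] at b3
    have hw : x ∈ M.willing μ f :=
      mem_willing.2 (gW.subst _ _ f (Finset.insert_subset_insert f hS') (by simp) b3)
    by_cases hx : (x, f) ∈ O
    · have hfμ : f ∈ μ.wm x := (μ.consistent _ _).1 (hO _ hx).1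
      rw [Finset.insert_eq_of_mem (hS' hfμ), e', ← ν.consistent] at b3
      exact b1 b3
    · have hxS : x ∈ S := (hS x).2 ⟨hw, hx⟩
      rw [gF.between e (Finset.subset_insert _ _) (Finset.insert_subset hxS hνS)] at b2
      exact b1 b2
  · have gF := goodF hsub hlad f
    obtain ⟨S, e, -, hS⟩ := kF f
    obtain ⟨hT, hCT⟩ := choice_willing hsub hlad hμ f
    have hνS : ν.fm f ⊆ S := by rw [← e]; exact gF.sub S
    exact gF.between hCT Finset.subset_union_left
      (Finset.union_subset hT (fun x hx => ((hS x).1 (hνS hx)).1))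
  · have gF := goodF hsub hlad f
    obtain ⟨S, e, h', hS⟩ := kF f
    have hνS : ν.fm f ⊆ S := by rw [← e]; exact gF.sub S
    exact gF.between e Finset.subset_union_left (Finset.union_subset hνS h')
  · rintro rfl
    obtain ⟨e, he⟩ := hne
    rcases (hν e.2 e.1).1 (hO e he).1 with h | ⟨e', he', h1, h2⟩
    · exact h.2 he
    · apply h0 e' he'
      rw [h1, h2]
      exact (hO e he).1

theorem main [Fintype W] {M : Market F W} (hsub : M.SubstAll) (hlad : M.LADAll)
    {μ μ' μW : Matching F W} (hμ : M.Stable μ) (hμ' : M.Stable μ') (hμW : M.Stable μW)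
    (hge : M.geF μ μ') (hne : μ ≠ μ') (hgeW : M.geF μ' μW)
    (hcov : ∀ ν, M.Stable ν → M.geF μ ν → M.geF ν μ' → ν ≠ μ → ν = μ') :
    M.IsCyclicMatching μ μW μ' := by
  let E : Set (W × F) := {e | e.1 ∈ μ.fm e.2 ∧ e.1 ∉ μ'.fm e.2}
  have hEfin : E.Finite := by
    apply (Finset.finite_toSet (Finset.univ.biUnion
      (fun w : W => (μ.wm w).image (fun f => (w, f))))).subset
    rintro ⟨w, f⟩ ⟨h, -⟩
    simp only [Finset.coe_biUnion, Set.mem_iUnion]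
    refine ⟨w, by simp, ?_⟩
    simpa using (μ.consistent _ _).1 h
  have hstep : ∀ e : W × F, ∃ e' : W × F, e ∈ E → (e' ∈ E ∧ e'.1 ∉ μ.fm e.2 ∧
      M.Cf e.2 (M.willing μ e.2 \ {e.1}) = insert e'.1 (μ.fm e.2 \ {e.1}) ∧
      M.Cw e'.1 (insert e.2 (μ.wm e'.1)) = insert e.2 (μ.wm e'.1 \ {e'.2})) := by
    intro e
    by_cases he : e ∈ E
    · obtain ⟨x, g, h1, h2, h3, h4, h5⟩ := step hsub hlad hμ hμ' hge he.1 he.2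
      exact ⟨(x, g), fun _ => ⟨⟨h2, h3⟩, h1, h4, h5⟩⟩
    · exact ⟨e, fun h => absurd h he⟩
  choose φ hφ using hstep
  obtain ⟨hrF, hrW⟩ := rural hsub hlad hμ hμ' hge
  have hEne : E.Nonempty := by
    by_contra hE
    apply hne
    apply Matching.ext_fm
    intro f
    apply Finset.eq_of_subset_of_card_le
    · intro w hw
      by_contra hw'
      exact hE ⟨(w, f), hw, hw'⟩
    · exact (hrF f).ge
  obtain ⟨e00, he00⟩ := hEne
  have hmaps : ∀ e ∈ E, ∀ n, φ^[n] e ∈ E := by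
    intro e he n
    induction n with
    | zero => exact he
    | succ n ih =>
      rw [Function.iterate_succ_apply']
      exact (hφ _ ih).1
  obtain ⟨e0, he0, r, hr, hper⟩ : ∃ e0 ∈ E, ∃ r, 0 < r ∧ φ^[r] e0 = e0 := by
    obtain ⟨a, -, b, -, hab, h⟩ := Set.infinite_univ.exists_ne_map_eq_of_mapsTo
      (f := fun n : ℕ => φ^[n] e00) (t := E) (fun n _ => hmaps _ he00 n) hEfin
    have key : ∀ a b : ℕ, a < b → φ^[a] e00 = φ^[b] e00 →
        ∃ e0 ∈ E, ∃ r, 0 < r ∧ φ^[r] e0 = e0 := by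
      intro a b hab h
      refine ⟨φ^[a] e00, hmaps _ he00 a, b - a, by omega, ?_⟩
      rw [← Function.iterate_add_apply, h]
      congr 2
      omega
    rcases lt_or_gt_of_ne hab with h' | h'
    · exact key a b h' h
    · exact key b a h' h.symm
  let e : ℕ → W × F := fun n => φ^[n] e0
  have heE : ∀ n, e n ∈ E := hmaps e0 he0
  have hes : ∀ n, e (n + 1) = φ (e n) := fun n => Function.iterate_succ_apply' φ n e0
  have hep : ∀ n, e (n + r) = e n := by
    intro n
    change φ^[n + r] e0 = φ^[n] e0
    rw [Function.iterate_add_apply, hper]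
  let O : Finset (W × F) := (Finset.range r).image e
  have hO : ∀ p, p ∈ O ↔ ∃ i < r, e i = p := by simp [O]
  have hOE : ∀ p ∈ O, p ∈ E := by
    intro p hp
    obtain ⟨i, -, rfl⟩ := (hO p).1 hp
    exact heE i
  have hφO : O.image φ = O := by
    ext p
    rw [Finset.mem_image]
    constructor
    · rintro ⟨q, hq, rfl⟩
      obtain ⟨i, hi, rfl⟩ := (hO q).1 hq
      rw [← hes]
      by_cases h : i + 1 = r
      · refine (hO _).2 ⟨0, hr, ?_⟩
        rw [h, ← hep 0, Nat.zero_add]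
      · exact (hO _).2 ⟨i + 1, by omega, rfl⟩
    · intro hp
      obtain ⟨i, hi, rfl⟩ := (hO p).1 hp
      rcases Nat.eq_zero_or_pos i with rfl | h
      · refine ⟨e (r - 1), (hO _).2 ⟨r - 1, by omega, rfl⟩, ?_⟩
        rw [← hes, ← hep 0]
        congr 1
        omega
      · refine ⟨e (i - 1), (hO _).2 ⟨i - 1, by omega, rfl⟩, ?_⟩
        rw [← hes]
        congr 1
        omega
  let w : ℕ → W := fun i => (e i).1
  let f : ℕ → F := fun i => (e i).2
  have hcyc : ∀ g x, x ∈ cyclicFm μ r w f g ↔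
      (x ∈ μ.fm g ∧ (x, g) ∉ O) ∨ ∃ p ∈ O, p.2 = g ∧ (φ p).1 = x := by
    intro g x
    have a1 : x ∈ ((Finset.range r).filter (fun i => f i = g)).image w ↔ (x, g) ∈ O := by
      rw [hO, Finset.mem_image]
      constructor
      · rintro ⟨i, hi, rfl⟩
        rw [Finset.mem_filter, Finset.mem_range] at hi
        exact ⟨i, hi.1, Prod.ext rfl hi.2⟩
      · rintro ⟨i, hi, h⟩
        refine ⟨i, ?_, congrArg Prod.fst h⟩
        rw [Finset.mem_filter, Finset.mem_range]
        exact ⟨hi, congrArg Prod.snd h⟩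
    have a2 : x ∈ ((Finset.range r).filter (fun i => f i = g)).image (fun i => w (i + 1)) ↔
        ∃ p ∈ O, p.2 = g ∧ (φ p).1 = x := by
      rw [Finset.mem_image]
      constructor
      · rintro ⟨i, hi, rfl⟩
        rw [Finset.mem_filter, Finset.mem_range] at hi
        exact ⟨e i, (hO _).2 ⟨i, hi.1, rfl⟩, hi.2, by rw [← hes]⟩
      · rintro ⟨p, hp, h1, h2⟩
        obtain ⟨i, hi, rfl⟩ := (hO p).1 hp
        refine ⟨i, ?_, ?_⟩
        · rw [Finset.mem_filter, Finset.mem_range]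
          exact ⟨hi, h1⟩
        · rw [← hes] at h2
          exact h2
    unfold cyclicFm
    split_ifs with hex
    · rw [Finset.mem_union, Finset.mem_sdiff, a1, a2]
    · constructor
      · intro hx
        refine Or.inl ⟨hx, fun hc => hex ?_⟩
        obtain ⟨i, hi, h⟩ := (hO _).1 hc
        exact ⟨i, Finset.mem_range.2 hi, congrArg Prod.snd h⟩
      · rintro (h | ⟨p, hp, h, -⟩)
        · exact h.1
        · exfalso
          apply hex
          obtain ⟨i, hi, rfl⟩ := (hO p).1 hp
          exact ⟨i, Finset.mem_range.2 hi, h⟩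
  let ν : Matching F W :=
    { fm := fun g => cyclicFm μ r w f g
      wm := fun x => (μ.wm x ∪ O.image Prod.snd).filter (fun g => x ∈ cyclicFm μ r w f g)
      consistent := by
        intro g x
        rw [Finset.mem_filter]
        refine ⟨fun h => ⟨?_, h⟩, fun h => h.2⟩
        rw [Finset.mem_union]
        rcases (hcyc g x).1 h with h' | ⟨p, hp, h1, -⟩
        · exact Or.inl ((μ.consistent _ _).1 h'.1)
        · exact Or.inr (Finset.mem_image.2 ⟨p, hp, h1⟩) }
  obtain ⟨n1, n2, n3, n4⟩ := rotate (ν := ν) hsub hlad hμ hμ' hge O φ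
    ⟨e 0, (hO _).2 ⟨0, hr, rfl⟩⟩ hφO hOE
    (fun p hp => (hφ p (hOE p hp)).2.1) (fun p hp => (hφ p (hOE p hp)).2.2.1)
    (fun p hp => (hφ p (hOE p hp)).2.2.2) hcyc
  have hν := hcov ν n1 n2 n3 n4
  refine ⟨r, w, f, ⟨hr, fun i => congrArg Prod.fst (hep i), fun i => congrArg Prod.snd (hep i),
    ?_⟩, fun g => by rw [← hν]⟩
  intro i
  have hgeμ : M.geF μ μW := fun g => (goodF hsub hlad g).trans (hge g) (hgeW g)
  have hgeμW := geW_of_geF hsub hlad hμW hgeμ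
  obtain ⟨hi1, hi2⟩ := heE i
  have hnext := hφ _ (heE i)
  rw [← hes] at hnext
  obtain ⟨-, c1, c2, c3⟩ := hnext
  have gF := goodF hsub hlad (e i).2
  -- the worker is not in `μW`
  have hnW : w i ∉ μW.fm (f i) := by
    intro hc
    apply hi2
    have h1 : M.Cf (e i).2 (μ'.fm (e i).2 ∪ μW.fm (e i).2) = μ'.fm (e i).2 := hgeW _
    have h2 : M.Cf (e i).2 (μ.fm (e i).2 ∪ μ'.fm (e i).2) = μ.fm (e i).2 := hge _
    have hc' : (e i).1 ∈ μW.fm (e i).2 := hc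
    have h3 : M.Cf (e i).2 (μ.fm (e i).2 ∪ (μ'.fm (e i).2 ∪ μW.fm (e i).2))
        = μ.fm (e i).2 := gF.trans h2 (by
          rw [← Finset.union_assoc, Finset.union_self]; exact h1)
    rw [← h1]
    exact gF.subst (μ.fm (e i).2 ∪ (μ'.fm (e i).2 ∪ μW.fm (e i).2)) _ _
      Finset.subset_union_right (Finset.mem_union_right _ hc') (by rw [h3]; exact hi1)
  have hWsub : μW.fm (e i).2 ⊆ M.willing μ (e i).2 \ {(e i).1} := by
    intro y hy
    refine Finset.mem_sdiff.2 ⟨sub_willing hsub hlad hgeμW _ hy, ?_⟩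
    rw [Finset.mem_singleton]
    rintro rfl
    exact hnW hy
  have hal : ∀ y ∈ insert (e (i + 1)).1 (μ.fm (e i).2 \ {(e i).1}),
      y ∉ M.Dall μ μW (e i).2 ∧ (e i).2 ∉ M.Eall μ μW y := by
    intro y hy
    rw [← c2] at hy
    have hy' := gF.sub _ hy
    exact alive hsub hlad hμ hμW
      (gF.subst _ _ y (Finset.insert_subset hy' hWsub) (Finset.mem_insert_self _ _) hy)
      (mem_willing.1 (Finset.mem_sdiff.1 hy').1)
  refine ⟨⟨hi1, hnW⟩, ?_, ?_⟩
  · refine bestIn_red _ (M.injF _) (M.Dall μ μW (e i).2) _ _ (M.willing μ (e i).2 \ {(e i).1})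
      c2.symm ?_ (fun y hy => (hal y hy).1) ?_
    · intro y hy
      have hy2 : y ∈ M.Cf (e i).2 (M.willing μ (e i).2 \ {(e i).1}) := by rw [c2]; exact hy
      have := gF.sub _ hy2
      refine Finset.mem_sdiff.2 ⟨Finset.mem_univ _, (Finset.mem_sdiff.1 this).2⟩
    · intro y hy hyD
      refine Finset.mem_sdiff.2 ⟨?_, (Finset.mem_sdiff.1 hy).2⟩
      rw [mem_willing]
      by_contra hc
      apply hyD
      refine Or.inr (Or.inr (Or.inr ?_))
      have gW := goodW hsub hlad y
      have h1 := gW.insert_not_mem (hμ.1.2 y) hc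
      have h2 : (e i).2 ∉ μ.wm y := by
        intro h
        rw [Finset.insert_eq_of_mem h, hμ.1.2 y] at hc
        exact hc h
      refine ⟨{(e i).2}, ⟨?_, ?_⟩, Finset.mem_singleton_self _, h2⟩
      · rw [Finset.union_comm]; exact h1
      · intro h
        exact h2 (by rw [h]; simp)
  · have hU : μ.wm (e (i + 1)).1 ∪ {(e i).2} = insert (e i).2 (μ.wm (e (i + 1)).1) := by
      rw [Finset.union_comm]; rfl
    refine bestIn_red _ (M.injW _) (M.Eall μ μW (e (i + 1)).1) _ _
      (insert (e i).2 (μ.wm (e (i + 1)).1)) c3.symm ?_ ?_ ?_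
    · intro g hg
      change g ∈ μ.wm (e (i + 1)).1 ∪ {(e i).2}
      rw [hU]
      rw [Finset.mem_insert, Finset.mem_sdiff] at hg
      rw [Finset.mem_insert]
      exact hg.imp id And.left
    · intro g hg
      rcases Finset.mem_insert.1 hg with rfl | hg
      · exact (hal _ (Finset.mem_insert_self _ _)).2
      · have hgμ := (Finset.mem_sdiff.1 hg).1
        have hgμ' := (μ.consistent _ _).2 hgμ
        refine (alive hsub hlad hμ hμW ?_ ?_).2
        · exact (goodF hsub hlad g).subst (μ.fm g ∪ μW.fm g) _ _
            (Finset.insert_subset (Finset.mem_union_left _ hgμ') Finset.subset_union_right)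
            (Finset.mem_insert_self _ _) (by
              have := hgeμ g
              unfold blairF at this
              rw [this]; exact hgμ')
        · exact (by rw [Finset.insert_eq_of_mem hgμ, hμ.1.2]; exact hgμ)
    · intro g hg _
      rw [← hU]
      exact hg

end helpers

end Market

/-- Proposition 4. With substitutable preferences satisfying the law of
aggregate demand, for every stable matching `μ' ≠ μ_F` there exists a stable matching `μ`
such that `μ'` is a cyclic matching under the reduced profile `P^μ = P^{μ,μ_W}`. -/
theorem stable_is_cyclic_matching {F W : Type*} [DecidableEq F] [DecidableEq W] [Fintype W]
    (M : Market F W) (hsub : M.SubstAll) (hlad : M.LADAll)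
    (μF μW : Matching F W)
    (hμF : M.Stable μF) (hFopt : ∀ ν, M.Stable ν → M.geF μF ν)
    (hμW : M.Stable μW) (hWopt : ∀ ν, M.Stable ν → M.geW μW ν)
    (μ' : Matching F W) (hμ' : M.Stable μ') (hne : μ' ≠ μF) :
    ∃ μ : Matching F W, M.Stable μ ∧ M.IsCyclicMatching μ μW μ' := by
  obtain ⟨μ, h1, h2, h3, h4⟩ := Market.exists_cover hsub hlad hμF hμ' (hFopt μ' hμ') hne
  exact ⟨μ, h1, Market.main hsub hlad h1 hμ' hμW h2 h3
    (Market.geF_of_geW hsub hlad hμ' (hWopt μ' hμ')) h4⟩
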